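/- Let 𝒢 be an n-player potential game with potential Φ where each player has at most m strategies, let ΔΦ be the maximum global variation of Φ, and let ζ be the maximum over ordered pairs of profiles (x,y) of the minimum over Hamming paths γ from x to y of the maximum potential increase ζ(γ) along γ. Then the logit dynamics with inverse noise β ≥ 0 satisfies: for every ε ∈ (0,1) and every integer t ≥ n·m^{2n+1}·e^{β·ζ}·(ln(1/ε) + β·ΔΦ + n·ln m), ‖P^t(x,·) − π‖_TV ≤ ε for every starting profile x ∈ S. -/

import Mathlib

noncomputable section

open Finset

variable {n : ℕ} {S : Fin n → Type*} [∀ i, Fintype (S i)] [∀ i, DecidableEq (S i)]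
  [∀ i, Nonempty (S i)]

/-- Logit update probability `σ_i(z ∣ x)` with inverse noise `β` for the game with
utilities `u`. -/
def logitSigma (β : ℝ) (u : Fin n → (∀ i, S i) → ℝ) (i : Fin n) (z : S i)
    (x : ∀ i, S i) : ℝ :=
  Real.exp (β * u i (Function.update x i z)) /
    ∑ w : S i, Real.exp (β * u i (Function.update x i w))

/-- Transition matrix of the logit dynamics with inverse noise `β`:
`P x y = (1/n) · σ_i(y_i ∣ x)` if `x` and `y` differ exactly in coordinate `i`,
`P x x = (1/n) · ∑ i, σ_i(x_i ∣ x)`, and `P x y = 0` otherwise. -/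
def logitP (β : ℝ) (u : Fin n → (∀ i, S i) → ℝ) :
    Matrix (∀ i, S i) (∀ i, S i) ℝ := fun x y =>
  (1 / (n : ℝ)) *
    ∑ i, if y = Function.update x i (y i) then logitSigma β u i (y i) x else 0

/-- `Φ` is an (exact) potential for the game with utilities `u`. -/
def IsPotential (u : Fin n → (∀ i, S i) → ℝ) (Φ : (∀ i, S i) → ℝ) : Prop :=
  ∀ (i : Fin n) (a b : S i) (x : ∀ i, S i),
    u i (Function.update x i a) - u i (Function.update x i b) =
      Φ (Function.update x i b) - Φ (Function.update x i a)

/-- The Gibbs measure `π(x) = exp(−β·Φ(x))/Z`. -/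
def gibbs (β : ℝ) (Φ : (∀ i, S i) → ℝ) (x : ∀ i, S i) : ℝ :=
  Real.exp (-β * Φ x) / ∑ y : ∀ i, S i, Real.exp (-β * Φ y)

/-- Total variation distance `(1/2)·∑ z, |μ z − ν z|`. -/
def tvDist {α : Type*} [Fintype α] (μ ν : α → ℝ) : ℝ :=
  (1 / 2) * ∑ z, |μ z - ν z|

/-- Maximum global variation `ΔΦ = max Φ − min Φ`. -/
def maxVar (Φ : (∀ i, S i) → ℝ) : ℝ :=
  sSup {d : ℝ | ∃ x y : ∀ i, S i, d = Φ x - Φ y}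

/-- Two profiles are adjacent if they differ in exactly one coordinate. -/
def Adjacent (x y : ∀ i, S i) : Prop :=
  (Finset.univ.filter fun i => x i ≠ y i).card = 1

/-- Maximum local variation `δΦ`. -/
def localVar (Φ : (∀ i, S i) → ℝ) : ℝ :=
  sSup {d : ℝ | ∃ x y : ∀ i, S i, Adjacent x y ∧ d = Φ x - Φ y}

/-- A Hamming path from `x` to `y`: a list of profiles starting at `x`, ending at `y`,
in which consecutive profiles differ in exactly one coordinate. -/
def IsHammingPath (x y : ∀ i, S i) (γ : List (∀ i, S i)) : Prop :=
  γ.head? = some x ∧ γ.getLast? = some y ∧ γ.Chain' Adjacent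

/-- `ζ(γ) = max_{0 ≤ i ≤ k} (Φ(z^i) − Φ(z^0))`, the maximum potential increase along a path. -/
def zetaPath (Φ : (∀ i, S i) → ℝ) : List (∀ i, S i) → ℝ
  | [] => 0
  | z :: rest => ((z :: rest).map fun w => Φ w - Φ z).foldr max 0

/-- `ζ(x,y)`: minimum over Hamming paths from `x` to `y` of `ζ(γ)`. -/
def zetaXY (Φ : (∀ i, S i) → ℝ) (x y : ∀ i, S i) : ℝ :=
  sInf {d : ℝ | ∃ γ : List (∀ i, S i), IsHammingPath x y γ ∧ d = zetaPath Φ γ}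

/-- `ζ = max_{x,y} ζ(x,y)`. -/
def zeta (Φ : (∀ i, S i) → ℝ) : ℝ :=
  sSup {d : ℝ | ∃ x y : ∀ i, S i, d = zetaXY Φ x y}

section ReversibleChain

variable {V : Type*} [Fintype V] {p : V → ℝ} {P : Matrix V V ℝ}

/-- The inner product `∑ x, p x * (f x * g x)` weighted by `p`. -/
def weightedInner (p f g : V → ℝ) : ℝ := ∑ x, p x * (f x * g x)

theorem weightedInner_comm (f g : V → ℝ) : weightedInner p f g = weightedInner p g f := by
  simp only [weightedInner, mul_comm]

theorem weightedInner_self_nonneg (hp : ∀ x, 0 < p x) (f : V → ℝ) :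
    0 ≤ weightedInner p f f :=
  Finset.sum_nonneg fun x _ => mul_nonneg (hp x).le (mul_self_nonneg _)

/-- A reversible kernel is self-adjoint for the weighted inner product. -/
theorem weightedInner_mulVec_comm (hrev : ∀ x y, p x * P x y = p y * P y x) (f g : V → ℝ) :
    weightedInner p (P.mulVec f) g = weightedInner p f (P.mulVec g) := by
  simp only [weightedInner, Matrix.mulVec, dotProduct, Finset.mul_sum, Finset.sum_mul]
  rw [Finset.sum_comm]
  refine Finset.sum_congr rfl fun x _ => Finset.sum_congr rfl fun y _ => ?_
  linear_combination (f x * g y) * hrev y x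

/-- Cauchy–Schwarz for the form `⟨P f, g⟩` of a positive semidefinite reversible kernel. -/
theorem weightedInner_mulVec_sq_le (hrev : ∀ x y, p x * P x y = p y * P y x)
    (hpsd : ∀ f, 0 ≤ weightedInner p f (P.mulVec f)) (f g : V → ℝ) :
    weightedInner p g (P.mulVec f) ^ 2 ≤
      weightedInner p f (P.mulVec f) * weightedInner p g (P.mulVec g) := by
  have key : ∀ s : ℝ, 0 ≤ weightedInner p g (P.mulVec g) * (s * s)
      + (2 * weightedInner p g (P.mulVec f)) * s + weightedInner p f (P.mulVec f) := by
    intro s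
    have h := hpsd (f + s • g)
    have h2 : weightedInner p f (P.mulVec g) = weightedInner p g (P.mulVec f) := by
      rw [← weightedInner_mulVec_comm hrev, weightedInner_comm]
    have h3 : weightedInner p (f + s • g) (P.mulVec (f + s • g)) =
        weightedInner p f (P.mulVec f) + s * weightedInner p f (P.mulVec g)
          + s * weightedInner p g (P.mulVec f) + s * s * weightedInner p g (P.mulVec g) := by
      rw [Matrix.mulVec_add, Matrix.mulVec_smul]
      simp only [weightedInner, Finset.mul_sum, ← Finset.sum_add_distrib]
      refine Finset.sum_congr rfl fun x _ => ?_
      simp only [Pi.add_apply, Pi.smul_apply, smul_eq_mul]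
      ring
    rw [h3, h2] at h
    linarith
  have := discrim_le_zero key
  rw [discrim] at this
  linarith

/-- If the kernel is positive semidefinite and bounded by `r` on a function and its image, it
contracts the norm of that function by `r`. -/
theorem weightedInner_mulVec_self_le (hp : ∀ x, 0 < p x)
    (hrev : ∀ x y, p x * P x y = p y * P y x)
    (hpsd : ∀ f, 0 ≤ weightedInner p f (P.mulVec f)) {r : ℝ} (hr : 0 ≤ r) (f : V → ℝ)
    (hf : weightedInner p f (P.mulVec f) ≤ r * weightedInner p f f)
    (hPf : weightedInner p (P.mulVec f) (P.mulVec (P.mulVec f)) ≤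
      r * weightedInner p (P.mulVec f) (P.mulVec f)) :
    weightedInner p (P.mulVec f) (P.mulVec f) ≤ r ^ 2 * weightedInner p f f := by
  have h1 := weightedInner_mulVec_sq_le hrev hpsd f (P.mulVec f)
  have h2 := mul_le_mul hf hPf (hpsd _)
    (mul_nonneg hr (weightedInner_self_nonneg hp f))
  have h3 := weightedInner_self_nonneg hp (P.mulVec f)
  have h4 := weightedInner_self_nonneg hp f
  rcases h3.eq_or_lt with h | h
  · rw [← h]; positivity
  · refine le_of_mul_le_mul_right ?_ h
    nlinarith

/-- The Dirichlet form of a reversible stochastic kernel. -/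
theorem sum_sum_mul_sub_sq (hrow : ∀ x, ∑ y, P x y = 1)
    (hrev : ∀ x y, p x * P x y = p y * P y x) (f : V → ℝ) :
    ∑ x, ∑ y, p x * P x y * (f x - f y) ^ 2 =
      2 * (weightedInner p f f - weightedInner p f (P.mulVec f)) := by
  have e : ∀ x y, p x * P x y * (f x - f y) ^ 2 =
      P x y * (p x * f x ^ 2) + P y x * (p y * f y ^ 2) - 2 * (p x * (f x * (P x y * f y))) := by
    intro x y
    linear_combination (f y ^ 2) * hrev x y
  have e1 : ∑ x, ∑ y, P x y * (p x * f x ^ 2) = weightedInner p f f := by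
    simp only [← Finset.sum_mul, hrow, weightedInner, one_mul, sq]
  have e2 : ∑ x, ∑ y, P y x * (p y * f y ^ 2) = weightedInner p f f := by
    rw [Finset.sum_comm, e1]
  have e3 : ∑ x, ∑ y, 2 * (p x * (f x * (P x y * f y))) =
      2 * weightedInner p f (P.mulVec f) := by
    simp only [weightedInner, Matrix.mulVec, dotProduct, Finset.mul_sum]
  simp only [e, Finset.sum_sub_distrib, Finset.sum_add_distrib, e1, e2, e3]
  ring

/-- The variance of a centred function as a double sum. -/
theorem sum_sum_mul_mul_sub_sq (hsum : ∑ x, p x = 1) (f : V → ℝ) (hf : ∑ x, p x * f x = 0) :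
    ∑ x, ∑ y, p x * p y * (f x - f y) ^ 2 = 2 * weightedInner p f f := by
  have h := sum_sum_mul_sub_sq (p := p) (P := fun _ y => p y) (fun _ => hsum)
    (fun x y => mul_comm _ _) f
  rw [h]
  simp [weightedInner, Matrix.mulVec, dotProduct, hf]

/-- A bound of each squared difference by the Dirichlet form yields a bound on the kernel on
centred functions. -/
theorem weightedInner_mulVec_le_of_sub_sq_le (hp : ∀ x, 0 < p x) (hsum : ∑ x, p x = 1)
    (hrow : ∀ x, ∑ y, P x y = 1) (hrev : ∀ x y, p x * P x y = p y * P y x) {K : ℝ}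
    (hK : ∀ (f : V → ℝ) (x y : V),
      p x * (f x - f y) ^ 2 ≤ K * ∑ z, ∑ w, p z * P z w * (f z - f w) ^ 2)
    {C : ℝ} (hC : 0 < C) (hCK : Fintype.card V * K = C) (f : V → ℝ)
    (hf : ∑ x, p x * f x = 0) :
    weightedInner p f (P.mulVec f) ≤ (1 - 1 / C) * weightedInner p f f := by
  have h1 : ∑ x, ∑ y, p x * p y * (f x - f y) ^ 2 ≤
      ∑ _x : V, ∑ y, p y * (K * ∑ z, ∑ w, p z * P z w * (f z - f w) ^ 2) := by
    refine Finset.sum_le_sum fun x _ => Finset.sum_le_sum fun y _ => ?_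
    have := mul_le_mul_of_nonneg_left (hK f x y) (hp y).le
    linarith
  rw [sum_sum_mul_mul_sub_sq hsum f hf, sum_sum_mul_sub_sq hrow hrev] at h1
  simp only [← Finset.sum_mul, hsum, Finset.sum_const, Finset.card_univ, nsmul_eq_mul,
    one_mul] at h1
  rw [← mul_assoc, hCK] at h1
  have h2 : 1 / C * weightedInner p f f ≤
      weightedInner p f f - weightedInner p f (P.mulVec f) := by
    rw [one_div, inv_mul_le_iff₀ hC]
    linarith
  linarith

variable [DecidableEq V]

theorem pow_reversible (hrev : ∀ x y, p x * P x y = p y * P y x) (t : ℕ) (x y : V) :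
    p x * (P ^ t) x y = p y * (P ^ t) y x := by
  induction t generalizing x y with
  | zero =>
    by_cases h : x = y
    · simp [h]
    · simp [h, Ne.symm h]
  | succ t ih =>
    rw [pow_succ, Matrix.mul_apply, ← pow_succ, pow_succ', Matrix.mul_apply, Finset.mul_sum,
      Finset.mul_sum]
    refine Finset.sum_congr rfl fun z _ => ?_
    linear_combination P z y * ih x z + (P ^ t) z x * hrev z y

/-- Geometric convergence in total variation of a reversible positive semidefinite chain that
contracts centred functions. -/
theorem tvDist_pow_le (hp : ∀ x, 0 < p x) (hsum : ∑ x, p x = 1)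
    (hrow : ∀ x, ∑ y, P x y = 1) (hrev : ∀ x y, p x * P x y = p y * P y x)
    (hpsd : ∀ f, 0 ≤ weightedInner p f (P.mulVec f)) {r : ℝ} (hr : 0 ≤ r)
    (hgap : ∀ f : V → ℝ, ∑ x, p x * f x = 0 →
      weightedInner p f (P.mulVec f) ≤ r * weightedInner p f f) (t : ℕ) (x : V) :
    tvDist ((P ^ t) x) p ≤ r ^ t / p x := by
  have hmean : ∀ f : V → ℝ, ∑ x, p x * f x = 0 → ∑ x, p x * (P.mulVec f) x = 0 := by
    intro f hf
    rw [← hf]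
    simp only [Matrix.mulVec, dotProduct, Finset.mul_sum]
    rw [Finset.sum_comm]
    refine Finset.sum_congr rfl fun y _ => ?_
    rw [← mul_one (p y * f y), ← hrow y, Finset.mul_sum]
    refine Finset.sum_congr rfl fun z _ => ?_
    linear_combination f y * hrev z y
  have hone : P.mulVec (fun _ => 1) = fun _ => 1 := by
    ext z; simp [Matrix.mulVec, dotProduct, hrow]
  have honet : (P ^ t).mulVec (fun _ => 1) = fun _ => 1 := by
    induction t with
    | zero => simp
    | succ t ih => rw [pow_succ, ← Matrix.mulVec_mulVec, hone, ih]
  have hiter : ∀ (s : ℕ) (f : V → ℝ), ∑ x, p x * f x = 0 →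
      ∑ x, p x * ((P ^ s).mulVec f) x = 0 ∧
      weightedInner p ((P ^ s).mulVec f) ((P ^ s).mulVec f) ≤
        (r ^ s) ^ 2 * weightedInner p f f := by
    intro s f hf
    induction s with
    | zero => simpa using hf
    | succ s ih =>
      obtain ⟨ih1, ih2⟩ := ih
      have e : (P ^ (s + 1)).mulVec f = P.mulVec ((P ^ s).mulVec f) := by
        rw [pow_succ', Matrix.mulVec_mulVec]
      rw [e]
      refine ⟨hmean _ ih1, ?_⟩
      have h := weightedInner_mulVec_self_le hp hrev hpsd hr _ (hgap _ ih1)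
        (hgap _ (hmean _ ih1))
      calc _ ≤ _ := h
        _ ≤ r ^ 2 * ((r ^ s) ^ 2 * weightedInner p f f) := by gcongr
        _ = _ := by ring
  set f : V → ℝ := fun y => (if y = x then 1 else 0) - p x with hfdef
  have hf0 : ∑ y, p y * f y = 0 := by
    simp [hfdef, mul_sub, Finset.sum_sub_distrib, ← Finset.sum_mul, hsum]
  have hfn : weightedInner p f f ≤ 1 := by
    have hpx : p x ≤ 1 := hsum ▸ Finset.single_le_sum (fun y _ => (hp y).le) (Finset.mem_univ x)
    rw [weightedInner, ← hsum]
    refine Finset.sum_le_sum fun y _ => ?_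
    have : f y * f y ≤ 1 := by
      simp only [hfdef]
      have := hp x
      split_ifs <;> nlinarith
    nlinarith [hp y]
  have hPf : ∀ y, ((P ^ t).mulVec f) y = (P ^ t) y x - p x := by
    intro y
    have h1 := congrFun honet y
    simp only [Matrix.mulVec, dotProduct, mul_one] at h1
    simp [hfdef, Matrix.mulVec, dotProduct, mul_sub, Finset.sum_sub_distrib, ← Finset.sum_mul, h1]
  set g := (P ^ t).mulVec f with hg
  have hgn : weightedInner p g g ≤ (r ^ t) ^ 2 :=
    (hiter t f hf0).2.trans (mul_le_of_le_one_right (by positivity) hfn)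
  have hl1 : ∑ y, p y * |g y| ≤ r ^ t := by
    refine abs_le_of_sq_le_sq' ?_ (by positivity) |>.2
    refine le_trans ?_ hgn
    have := Finset.sum_sq_le_sum_mul_sum_of_sq_le_mul Finset.univ (r := fun y => p y * |g y|)
      (f := p) (g := fun y => p y * (g y * g y)) (fun y _ => (hp y).le)
      (fun y _ => mul_nonneg (hp y).le (mul_self_nonneg _))
      (fun y _ => by rw [mul_pow, sq_abs]; exact le_of_eq (by ring))
    rwa [hsum, one_mul] at this
  have hterm : ∀ y, |(P ^ t) x y - p y| = p y * |g y| / p x := by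
    intro y
    rw [hPf, eq_div_iff (hp x).ne']
    have h : ((P ^ t) x y - p y) * p x = p y * ((P ^ t) y x - p x) := by
      linear_combination pow_reversible hrev t x y
    have h' := congrArg abs h
    rwa [abs_mul, abs_mul, abs_of_pos (hp x), abs_of_pos (hp y)] at h'
  rw [tvDist]
  simp only [hterm, ← Finset.sum_div]
  have h0 : 0 ≤ r ^ t / p x := div_nonneg (by positivity) (hp x).le
  have : (∑ y, p y * |g y|) / p x ≤ r ^ t / p x := div_le_div_of_nonneg_right hl1 (hp x).le
  linarith

/-- Squared differences along a path of a graph whose edges all carry conductance at least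
`c / K`. -/
theorem sub_sq_le_of_reachable {Q : V → V → ℝ} (hQ : ∀ z w, 0 ≤ Q z w) {c K : ℝ} (hc : 0 ≤ c)
    (hK : 0 ≤ K) (G : SimpleGraph V) (hG : ∀ z w, G.Adj z w → c ≤ K * Q z w)
    {x y : V} (hxy : G.Reachable x y) (f : V → ℝ) :
    c * (f x - f y) ^ 2 ≤
      Fintype.card V * K * ∑ z, ∑ w, Q z w * (f z - f w) ^ 2 := by
  obtain ⟨q⟩ := hxy
  obtain ⟨q, hq⟩ := q.toPath
  have hd : q.darts.Nodup := hq.isTrail.edges_nodup |>.of_map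
  have htel : ∀ {a b : V} (w : G.Walk a b),
      (w.darts.map fun d => f d.fst - f d.snd).sum = f a - f b := by
    intro a b w
    induction w with
    | nil => simp
    | cons h w ih => simp [ih]
  classical
  set s : Finset (V × V) := q.darts.toFinset.image SimpleGraph.Dart.toProd with hs
  have hsinj : Set.InjOn SimpleGraph.Dart.toProd (q.darts.toFinset : Set G.Dart) :=
    fun a _ b _ h => SimpleGraph.Dart.toProd_injective h
  have hsum : ∑ e ∈ s, (f e.1 - f e.2) = f x - f y := by
    rw [hs, Finset.sum_image hsinj, ← htel q, List.sum_toFinset _ hd]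
  have hcard : s.card ≤ Fintype.card V := by
    refine Finset.card_image_le.trans ((List.toFinset_card_le _).trans ?_)
    rw [SimpleGraph.Walk.length_darts]
    exact hq.length_lt.le
  have hadj : ∀ e ∈ s, c ≤ K * Q e.1 e.2 := by
    intro e he
    obtain ⟨d, -, rfl⟩ := Finset.mem_image.1 he
    exact hG _ _ d.adj
  have hcs : (f x - f y) ^ 2 ≤ s.card * ∑ e ∈ s, (f e.1 - f e.2) ^ 2 := by
    rw [← hsum]; exact sq_sum_le_card_mul_sum_sq
  calc c * (f x - f y) ^ 2 ≤ c * (s.card * ∑ e ∈ s, (f e.1 - f e.2) ^ 2) := by gcongr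
    _ = s.card * ∑ e ∈ s, c * (f e.1 - f e.2) ^ 2 := by
      rw [← Finset.mul_sum, mul_left_comm]
    _ ≤ Fintype.card V * ∑ e ∈ s, K * Q e.1 e.2 * (f e.1 - f e.2) ^ 2 := by
      gcongr with e he
      exact hadj e he
    _ ≤ Fintype.card V * ∑ e : V × V, K * Q e.1 e.2 * (f e.1 - f e.2) ^ 2 := by
      refine mul_le_mul_of_nonneg_left (Finset.sum_le_univ_sum_of_nonneg fun e => ?_)
        (Nat.cast_nonneg _)
      exact mul_nonneg (mul_nonneg hK (hQ _ _)) (sq_nonneg _)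
    _ = _ := by
      rw [Fintype.sum_prod_type, mul_assoc]
      simp only [Finset.mul_sum, mul_assoc]

end ReversibleChain

section Profiles

set_option linter.unusedSectionVars false

theorem gibbs_pos (β : ℝ) (Φ : (∀ i, S i) → ℝ) (x : ∀ i, S i) : 0 < gibbs β Φ x :=
  div_pos (Real.exp_pos _) (Finset.sum_pos (fun _ _ => Real.exp_pos _) Finset.univ_nonempty)

theorem sum_gibbs (β : ℝ) (Φ : (∀ i, S i) → ℝ) : ∑ x, gibbs β Φ x = 1 := by
  simp only [gibbs, ← Finset.sum_div]
  exact div_self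
    (Finset.sum_pos (fun _ _ => Real.exp_pos _) Finset.univ_nonempty).ne'

theorem gibbs_le_exp_mul_gibbs {β : ℝ} (hβ : 0 ≤ β) {Φ : (∀ i, S i) → ℝ} {x y : ∀ i, S i} {c : ℝ}
    (h : Φ y ≤ Φ x + c) : gibbs β Φ x ≤ Real.exp (β * c) * gibbs β Φ y := by
  rw [gibbs, gibbs, ← mul_div_assoc, ← Real.exp_add]
  have := mul_le_mul_of_nonneg_left h hβ
  gcongr
  linarith

/-- The total Gibbs mass of the line through `x` in direction `i`. -/
def lineMass (β : ℝ) (Φ : (∀ i, S i) → ℝ) (i : Fin n) (x : ∀ i, S i) : ℝ :=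
  ∑ a : S i, gibbs β Φ (Function.update x i a)

theorem lineMass_pos (β : ℝ) (Φ : (∀ i, S i) → ℝ) (i : Fin n) (x : ∀ i, S i) :
    0 < lineMass β Φ i x :=
  Finset.sum_pos (fun _ _ => gibbs_pos _ _ _) Finset.univ_nonempty

theorem lineMass_update (β : ℝ) (Φ : (∀ i, S i) → ℝ) (i : Fin n) (x : ∀ i, S i) (a : S i) :
    lineMass β Φ i (Function.update x i a) = lineMass β Φ i x := by
  simp [lineMass]

theorem logitSigma_eq {u : Fin n → (∀ i, S i) → ℝ} {Φ : (∀ i, S i) → ℝ} (hpot : IsPotential u Φ)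
    (β : ℝ) (i : Fin n) (z : S i) (x : ∀ i, S i) :
    logitSigma β u i z x = gibbs β Φ (Function.update x i z) / lineMass β Φ i x := by
  have hZ : 0 < ∑ y : ∀ i, S i, Real.exp (-β * Φ y) :=
    Finset.sum_pos (fun _ _ => Real.exp_pos _) Finset.univ_nonempty
  have h : ∀ a, Real.exp (β * u i (Function.update x i a)) =
      (Real.exp (β * (u i x + Φ x)) * ∑ y : ∀ i, S i, Real.exp (-β * Φ y)) *
        gibbs β Φ (Function.update x i a) := by
    intro a
    have := hpot i a (x i) x
    rw [Function.update_eq_self] at this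
    rw [gibbs, mul_assoc, mul_div_cancel₀ _ hZ.ne', ← Real.exp_add]
    congr 1
    linear_combination β * this
  simp only [logitSigma, h, ← Finset.mul_sum]
  exact mul_div_mul_left _ _ (mul_pos (Real.exp_pos _) hZ).ne'

theorem sum_ite_eq_update (i : Fin n) (x : ∀ i, S i) (g : (∀ i, S i) → ℝ) :
    ∑ y, (if y = Function.update x i (y i) then g y else 0) =
      ∑ a : S i, g (Function.update x i a) := by
  rw [← Finset.sum_filter]
  refine Finset.sum_nbij' (fun y => y i) (fun a => Function.update x i a) ?_ ?_ ?_ ?_ ?_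
  · simp
  · simp
  · intro y hy
    exact (Finset.mem_filter.1 hy).2.symm
  · simp
  · intro y hy
    rw [← (Finset.mem_filter.1 hy).2]

theorem sum_sum_update (i : Fin n) (g : (∀ i, S i) → ℝ) :
    ∑ x, ∑ a : S i, g (Function.update x i a) = Fintype.card (S i) * ∑ x, g x := by
  have h : ∑ q : (∀ i, S i) × S i, g (Function.update q.1 i q.2) =
      ∑ q : (∀ i, S i) × S i, g q.1 := by
    refine Finset.sum_nbij' (fun q => (Function.update q.1 i q.2, q.1 i))
      (fun q => (Function.update q.1 i q.2, q.1 i)) ?_ ?_ ?_ ?_ ?_ <;> simp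
  rw [Fintype.sum_prod_type, Fintype.sum_prod_type] at h
  simpa [Finset.mul_sum] using h

theorem logitP_mulVec {u : Fin n → (∀ i, S i) → ℝ} {Φ : (∀ i, S i) → ℝ} (hpot : IsPotential u Φ)
    (β : ℝ) (f : (∀ i, S i) → ℝ) (x : ∀ i, S i) :
    (logitP β u).mulVec f x = (1 / (n : ℝ)) * ∑ i, (∑ a : S i,
      gibbs β Φ (Function.update x i a) * f (Function.update x i a)) / lineMass β Φ i x := by
  simp only [Matrix.mulVec, dotProduct, logitP, mul_assoc, ← Finset.mul_sum, Finset.sum_mul]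
  congr 1
  rw [Finset.sum_comm]
  refine Finset.sum_congr rfl fun i _ => ?_
  simp only [ite_mul, zero_mul]
  rw [sum_ite_eq_update i x (fun y => logitSigma β u i (y i) x * f y), Finset.sum_div]
  refine Finset.sum_congr rfl fun a _ => ?_
  rw [Function.update_self, logitSigma_eq hpot]
  ring

theorem sum_logitP (hn : 1 ≤ n) {u : Fin n → (∀ i, S i) → ℝ} {Φ : (∀ i, S i) → ℝ}
    (hpot : IsPotential u Φ) (β : ℝ) (x : ∀ i, S i) : ∑ y, logitP β u x y = 1 := by
  have h := logitP_mulVec hpot β (fun _ => 1) x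
  have hn' : (n : ℝ) ≠ 0 := by positivity
  simp only [mul_one] at h
  have h' : ∀ i, (∑ a : S i, gibbs β Φ (Function.update x i a)) / lineMass β Φ i x = 1 :=
    fun i => div_self (lineMass_pos β Φ i x).ne'
  simpa [Matrix.mulVec, dotProduct, h', hn'] using h

theorem logitP_reversible {u : Fin n → (∀ i, S i) → ℝ} {Φ : (∀ i, S i) → ℝ}
    (hpot : IsPotential u Φ) (β : ℝ) (x y : ∀ i, S i) :
    gibbs β Φ x * logitP β u x y = gibbs β Φ y * logitP β u y x := by
  simp only [logitP]
  rw [mul_left_comm, mul_left_comm (gibbs β Φ y), Finset.mul_sum univ _ (gibbs β Φ x),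
    Finset.mul_sum univ _ (gibbs β Φ y)]
  refine congrArg (1 / (n : ℝ) * ·) (Finset.sum_congr rfl fun i _ => ?_)
  have aux : ∀ {v w : ∀ i, S i}, w = Function.update v i (w i) → v = Function.update w i (v i) := by
    intro v w h
    rw [h]; simp
  by_cases h : y = Function.update x i (y i)
  · rw [if_pos h, if_pos (aux h), logitSigma_eq hpot, logitSigma_eq hpot, ← h, ← aux h]
    have : lineMass β Φ i y = lineMass β Φ i x := by rw [h, lineMass_update]
    rw [this]
    ring
  · rw [if_neg h, if_neg fun h' => h (aux h')]
    simp

theorem logitP_nonneg (β : ℝ) (u : Fin n → (∀ i, S i) → ℝ) (x y : ∀ i, S i) :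
    0 ≤ logitP β u x y := by
  refine mul_nonneg (by positivity) (Finset.sum_nonneg fun i _ => ?_)
  split_ifs
  · exact div_nonneg (Real.exp_pos _).le (Finset.sum_nonneg fun _ _ => (Real.exp_pos _).le)
  · exact le_rfl

/-- The logit dynamics is an average of conditional expectations, hence positive semidefinite. -/
theorem logitP_posSemidef {u : Fin n → (∀ i, S i) → ℝ} {Φ : (∀ i, S i) → ℝ}
    (hpot : IsPotential u Φ) (β : ℝ) (f : (∀ i, S i) → ℝ) :
    0 ≤ weightedInner (gibbs β Φ) f ((logitP β u).mulVec f) := by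
  set F : ∀ i, (∀ i, S i) → ℝ := fun i x => ∑ a : S i,
      gibbs β Φ (Function.update x i a) * f (Function.update x i a) with hF
  have hFu : ∀ i x (a : S i), F i (Function.update x i a) = F i x := by
    intro i x a; simp [hF]
  have h1 : weightedInner (gibbs β Φ) f ((logitP β u).mulVec f) =
      (1 / (n : ℝ)) * ∑ i, ∑ x, gibbs β Φ x * f x * (F i x / lineMass β Φ i x) := by
    simp only [weightedInner, logitP_mulVec hpot]
    rw [Finset.sum_comm, Finset.mul_sum]
    refine Finset.sum_congr rfl fun x _ => ?_
    rw [← Finset.mul_sum]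
    ring
  rw [h1]
  refine mul_nonneg (by positivity) (Finset.sum_nonneg fun i _ => ?_)
  have hc : (0 : ℝ) < Fintype.card (S i) := by exact_mod_cast Fintype.card_pos
  refine nonneg_of_mul_nonneg_right (a := (Fintype.card (S i) : ℝ)) ?_ hc
  rw [← sum_sum_update]
  refine Finset.sum_nonneg fun x _ => ?_
  simp only [hFu, lineMass_update, ← Finset.sum_mul]
  rw [show ∑ a : S i, gibbs β Φ (Function.update x i a) * f (Function.update x i a) = F i x from rfl,
    ← mul_div_assoc]
  exact div_nonneg (mul_self_nonneg _) (lineMass_pos _ _ _ _).le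

/-- Moving to the most likely profile of a line has conductance at least `gibbs x / (n * m)`. -/
theorem gibbs_le_mul_logitP {m : ℕ} (hm : ∀ i, Fintype.card (S i) ≤ m)
    {u : Fin n → (∀ i, S i) → ℝ} {Φ : (∀ i, S i) → ℝ} (hpot : IsPotential u Φ) (β : ℝ)
    (i : Fin n) (x : ∀ i, S i) (a : S i)
    (ha : ∀ b, gibbs β Φ (Function.update x i b) ≤ gibbs β Φ (Function.update x i a)) :
    gibbs β Φ x ≤
      (n * m : ℝ) * (gibbs β Φ x * logitP β u x (Function.update x i a)) := by
  have hn : (n : ℝ) ≠ 0 := by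
    have := i.pos
    positivity
  have h1 : 1 ≤ m * logitSigma β u i a x := by
    rw [logitSigma_eq hpot, ← mul_div_assoc, one_le_div (lineMass_pos _ _ _ _)]
    calc lineMass β Φ i x ≤ ∑ _b : S i, gibbs β Φ (Function.update x i a) :=
          Finset.sum_le_sum fun b _ => ha b
      _ = Fintype.card (S i) * gibbs β Φ (Function.update x i a) := by simp
      _ ≤ _ := mul_le_mul_of_nonneg_right (by exact_mod_cast hm i) (gibbs_pos _ _ _).le
  have h2 : logitSigma β u i a x ≤ n * logitP β u x (Function.update x i a) := by
    rw [logitP, ← mul_assoc, mul_one_div_cancel hn, one_mul]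
    refine le_trans (le_of_eq ?_) (Finset.single_le_sum (fun j _ => ?_) (Finset.mem_univ i))
    · simp
    · split_ifs
      · exact div_nonneg (Real.exp_pos _).le (Finset.sum_nonneg fun _ _ => (Real.exp_pos _).le)
      · exact le_rfl
  have h3 : 1 ≤ m * (n * logitP β u x (Function.update x i a)) :=
    h1.trans (mul_le_mul_of_nonneg_left h2 (Nat.cast_nonneg _))
  nlinarith [gibbs_pos β Φ x]

theorem adjacent_iff_exists_update {x y : ∀ i, S i} :
    Adjacent x y ↔ ∃ i a, a ≠ x i ∧ y = Function.update x i a := by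
  rw [Adjacent, Finset.card_eq_one]
  constructor
  · rintro ⟨i, hi⟩
    have hmem : ∀ j, x j ≠ y j ↔ j = i := fun j => by
      rw [← Finset.mem_singleton, ← hi]; simp
    refine ⟨i, y i, ((hmem i).2 rfl).symm, funext fun j => ?_⟩
    by_cases hj : j = i
    · subst hj; simp
    · rw [Function.update_of_ne hj]
      exact (not_not.1 fun h => hj ((hmem j).1 h)).symm
  · rintro ⟨i, a, ha, rfl⟩
    refine ⟨i, Finset.ext fun j => ?_⟩
    by_cases hj : j = i
    · subst hj; simpa using ha.symm
    · simp [hj]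

theorem exists_isHammingPath (x y : ∀ i, S i) : ∃ γ, IsHammingPath x y γ := by
  have h : ∀ s : Finset (Fin n), Relation.ReflTransGen Adjacent x (s.piecewise y x) := by
    intro s
    induction s using Finset.induction_on with
    | empty => simpa using Relation.ReflTransGen.refl
    | insert j s hj ih =>
      rw [Finset.piecewise_insert]
      by_cases hjs : y j = s.piecewise y x j
      · rwa [hjs, Function.update_eq_self]
      · exact ih.tail (adjacent_iff_exists_update.2 ⟨j, y j, hjs, rfl⟩)
  have h' := h Finset.univ
  rw [Finset.piecewise_univ] at h'
  obtain ⟨l, hl, hlast⟩ := List.exists_isChain_cons_of_relationReflTransGen h'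
  exact ⟨x :: l, rfl, by rw [List.getLast?_eq_getLast_of_ne_nil (List.cons_ne_nil x l), hlast], hl⟩

theorem le_foldr_max_zero {l : List ℝ} {a : ℝ} (h : a ∈ l) : a ≤ l.foldr max 0 := by
  induction l with
  | nil => simp at h
  | cons b l ih =>
    rcases List.mem_cons.1 h with rfl | h
    · exact le_max_left _ _
    · exact (ih h).trans (le_max_right _ _)

theorem foldr_max_zero_mem (l : List ℝ) : l.foldr max 0 = 0 ∨ l.foldr max 0 ∈ l := by
  induction l with
  | nil => simp
  | cons b l ih =>
    rw [List.foldr_cons]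
    rcases max_choice b (l.foldr max 0) with h | h
    · rw [h]; simp
    · rw [h]
      exact ih.imp id (List.mem_cons_of_mem b)

theorem zetaPath_nonneg (Φ : (∀ i, S i) → ℝ) (γ : List (∀ i, S i)) : 0 ≤ zetaPath Φ γ := by
  cases γ with
  | nil => exact le_rfl
  | cons z l =>
    have : Φ z - Φ z ≤ zetaPath Φ (z :: l) := le_foldr_max_zero (by simp)
    simpa using this

theorem zeta_nonneg (Φ : (∀ i, S i) → ℝ) : 0 ≤ zeta Φ := by
  refine Real.sSup_nonneg ?_
  rintro _ ⟨x, y, rfl⟩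
  refine Real.sInf_nonneg ?_
  rintro _ ⟨γ, -, rfl⟩
  exact zetaPath_nonneg Φ γ

/-- Between any two profiles there is a Hamming path climbing at most `zeta Φ`. -/
theorem exists_isHammingPath_le_zeta (Φ : (∀ i, S i) → ℝ) (x y : ∀ i, S i) :
    ∃ γ, IsHammingPath x y γ ∧ ∀ w ∈ γ, Φ w ≤ Φ x + zeta Φ := by
  have hfin : {d : ℝ | ∃ γ : List (∀ i, S i), IsHammingPath x y γ ∧ d = zetaPath Φ γ}.Finite := by
    refine ((Set.finite_range fun w => Φ w - Φ x).insert 0).subset ?_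
    rintro _ ⟨γ, hγ, rfl⟩
    cases γ with
    | nil => exact Or.inl rfl
    | cons z l =>
      obtain rfl : z = x := by simpa using hγ.1
      refine (foldr_max_zero_mem _).imp id fun h => ?_
      obtain ⟨w, -, hw⟩ := List.mem_map.1 h
      exact ⟨w, hw⟩
  obtain ⟨γ₀, hγ₀⟩ := exists_isHammingPath x y
  have hne : {d : ℝ | ∃ γ : List (∀ i, S i), IsHammingPath x y γ ∧ d = zetaPath Φ γ}.Nonempty :=
    ⟨_, γ₀, hγ₀, rfl⟩
  obtain ⟨γ, hγ, hζ⟩ := hne.csInf_mem hfin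
  refine ⟨γ, hγ, fun w hw => ?_⟩
  have hle : zetaXY Φ x y ≤ zeta Φ := by
    refine le_csSup (Set.Finite.bddAbove ?_) ⟨x, y, rfl⟩
    refine (Set.finite_range fun q : (∀ i, S i) × (∀ i, S i) => zetaXY Φ q.1 q.2).subset ?_
    rintro _ ⟨a, b, rfl⟩
    exact ⟨(a, b), rfl⟩
  have hζ' : zetaXY Φ x y = zetaPath Φ γ := hζ
  cases γ with
  | nil => simp at hw
  | cons z l =>
    obtain rfl : z = x := by simpa using hγ.1
    have : Φ w - Φ z ≤ zetaPath Φ (z :: l) := le_foldr_max_zero (List.mem_map.2 ⟨w, hw, rfl⟩)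
    linarith

theorem sub_le_maxVar (Φ : (∀ i, S i) → ℝ) (x y : ∀ i, S i) : Φ x - Φ y ≤ maxVar Φ := by
  refine le_csSup (Set.Finite.bddAbove ?_) ⟨x, y, rfl⟩
  refine (Set.finite_range fun q : (∀ i, S i) × (∀ i, S i) => Φ q.1 - Φ q.2).subset ?_
  rintro _ ⟨a, b, rfl⟩
  exact ⟨(a, b), rfl⟩

theorem logitP_sub_sq_le {m : ℕ} (hm : ∀ i, Fintype.card (S i) ≤ m)
    {u : Fin n → (∀ i, S i) → ℝ} {Φ : (∀ i, S i) → ℝ} (hpot : IsPotential u Φ) {β : ℝ}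
    (hβ : 0 ≤ β) (f : (∀ i, S i) → ℝ) (x y : ∀ i, S i) :
    gibbs β Φ x * (f x - f y) ^ 2 ≤
      Fintype.card (∀ i, S i) * (Real.exp (β * zeta Φ) * (n * m)) *
        ∑ z, ∑ w, gibbs β Φ z * logitP β u z w * (f z - f w) ^ 2 := by
  set K : ℝ := Real.exp (β * zeta Φ) * (n * m) with hK
  let G : SimpleGraph (∀ i, S i) :=
    { Adj := fun z w => z ≠ w ∧ gibbs β Φ x ≤ K * (gibbs β Φ z * logitP β u z w)
      symm := ⟨fun z w h => ⟨h.1.symm, by rw [logitP_reversible hpot]; exact h.2⟩⟩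
      loopless := ⟨fun z h => h.1 rfl⟩ }
  have hmode : ∀ (i : Fin n) (z : ∀ i, S i), Φ z ≤ Φ x + zeta Φ → ∀ a : S i,
      (∀ b, gibbs β Φ (Function.update z i b) ≤ gibbs β Φ (Function.update z i a)) →
      G.Reachable z (Function.update z i a) := by
    intro i z hz a ha
    by_cases h : z = Function.update z i a
    · rw [← h]
    · refine SimpleGraph.Adj.reachable ⟨h, ?_⟩
      calc gibbs β Φ x ≤ Real.exp (β * zeta Φ) * gibbs β Φ z := gibbs_le_exp_mul_gibbs hβ hz
        _ ≤ Real.exp (β * zeta Φ) *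
            ((n * m) * (gibbs β Φ z * logitP β u z (Function.update z i a))) := by
          gcongr
          exact gibbs_le_mul_logitP hm hpot β i z a ha
        _ = _ := by rw [hK]; ring
  have hstep : ∀ z w, Φ z ≤ Φ x + zeta Φ → Φ w ≤ Φ x + zeta Φ → Adjacent z w →
      G.Reachable z w := by
    intro z w hz hw hzw
    obtain ⟨i, b, -, rfl⟩ := adjacent_iff_exists_update.1 hzw
    obtain ⟨a, ha⟩ := Finite.exists_max fun b => gibbs β Φ (Function.update z i b)
    have h := hmode i _ hw a (by simpa using ha)
    rw [Function.update_idem] at h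
    exact (hmode i z hz a ha).trans h.symm
  have hpath : ∀ (γ : List (∀ i, S i)) (z : ∀ i, S i), IsHammingPath z y γ →
      (∀ w ∈ γ, Φ w ≤ Φ x + zeta Φ) → G.Reachable z y := by
    intro γ
    induction γ with
    | nil => intro z h; simp [IsHammingPath] at h
    | cons v l ih =>
      rintro z ⟨h1, h2, h3⟩ hl
      obtain rfl : v = z := by simpa using h1
      cases l with
      | nil =>
        obtain rfl : v = y := by simpa using h2
        exact SimpleGraph.Reachable.refl _
      | cons w l =>
        obtain ⟨hvw, h3⟩ := List.isChain_cons_cons.1 h3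
        refine (hstep v w (hl _ (by simp)) (hl _ (by simp)) hvw).trans
          (ih w ⟨rfl, by simpa using h2, h3⟩ fun w' hw' => hl w' (List.mem_cons_of_mem _ hw'))
  obtain ⟨γ, hγ, hζ⟩ := exists_isHammingPath_le_zeta Φ x y
  exact sub_sq_le_of_reachable
    (fun z w => mul_nonneg (gibbs_pos β Φ z).le (logitP_nonneg β u z w)) (gibbs_pos β Φ x).le
    (by positivity) G (fun z w h => h.2) (hpath γ x hγ hζ) f

theorem inv_gibbs_le {β : ℝ} (hβ : 0 ≤ β) (Φ : (∀ i, S i) → ℝ) (x : ∀ i, S i) :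
    1 / gibbs β Φ x ≤ Fintype.card (∀ i, S i) * Real.exp (β * maxVar Φ) := by
  rw [div_le_iff₀ (gibbs_pos β Φ x), ← sum_gibbs β Φ, mul_assoc, ← nsmul_eq_mul]
  refine Finset.sum_le_card_nsmul _ _ _ fun y _ => gibbs_le_exp_mul_gibbs hβ ?_
  linarith [sub_le_maxVar Φ x y]

end Profiles

/-- Mixing time upper bound in terms of `ζ`: after
`t ≥ n·m^{2n+1}·e^{β·ζ}·(ln(1/ε) + β·ΔΦ + n·ln m)` steps the logit dynamics is within
total variation distance `ε` of the Gibbs measure, from every starting profile. -/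
theorem logit_mixing_zeta_bound
    (hn : 1 ≤ n) (m : ℕ) (hm : ∀ i, Fintype.card (S i) ≤ m)
    (u : Fin n → (∀ i, S i) → ℝ) (Φ : (∀ i, S i) → ℝ)
    (hpot : IsPotential u Φ) (β : ℝ) (hβ : 0 ≤ β) :
    ∀ ε : ℝ, 0 < ε → ε < 1 → ∀ t : ℕ,
      (n : ℝ) * (m : ℝ) ^ (2 * n + 1) * Real.exp (β * zeta Φ) *
          (Real.log (1 / ε) + β * maxVar Φ + (n : ℝ) * Real.log (m : ℝ)) ≤ (t : ℝ) →
      ∀ x : ∀ i, S i, tvDist ((logitP β u ^ t) x) (gibbs β Φ) ≤ ε := by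
  intro ε hε hε1 t ht x
  have hm1 : 1 ≤ m := le_trans Fintype.card_pos (hm ⟨0, hn⟩)
  have hmpos : (0 : ℝ) < m := by exact_mod_cast hm1
  have hcard : (Fintype.card (∀ i, S i) : ℝ) ≤ (m : ℝ) ^ n := by
    rw [Fintype.card_pi]
    exact_mod_cast (Finset.prod_le_pow_card _ _ _ fun i _ => hm i).trans (by simp)
  have hcard0 : (0 : ℝ) ≤ Fintype.card (∀ i, S i) := Nat.cast_nonneg _
  set E := Real.exp (β * zeta Φ) with hE
  have hE1 : 1 ≤ E := Real.one_le_exp (mul_nonneg hβ (zeta_nonneg Φ))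
  set C : ℝ := (n : ℝ) * (m : ℝ) ^ (2 * n + 1) * E with hC
  have hC1 : 1 ≤ C := by
    have h1 : (1 : ℝ) ≤ n := by exact_mod_cast hn
    have h2 : (1 : ℝ) ≤ (m : ℝ) ^ (2 * n + 1) := one_le_pow₀ (by exact_mod_cast hm1)
    exact one_le_mul_of_one_le_of_one_le (one_le_mul_of_one_le_of_one_le h1 h2) hE1
  have hC0 : 0 < C := by linarith
  have hcard1 : (0 : ℝ) < Fintype.card (∀ i, S i) := by exact_mod_cast Fintype.card_pos
  have hr0 : 0 ≤ 1 - 1 / C := by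
    rw [sub_nonneg, div_le_one hC0]; exact hC1
  have hgap : ∀ f : (∀ i, S i) → ℝ, ∑ x, gibbs β Φ x * f x = 0 →
      weightedInner (gibbs β Φ) f ((logitP β u).mulVec f) ≤
        (1 - 1 / C) * weightedInner (gibbs β Φ) f f := by
    refine weightedInner_mulVec_le_of_sub_sq_le (gibbs_pos β Φ) (sum_gibbs β Φ)
      (sum_logitP hn hpot β) (logitP_reversible hpot β)
      (K := C / Fintype.card (∀ i, S i)) (fun f x y => ?_) hC0 (by field_simp)
    refine (logitP_sub_sq_le hm hpot hβ f x y).trans ?_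
    refine mul_le_mul_of_nonneg_right ?_ (Finset.sum_nonneg fun z _ => Finset.sum_nonneg fun w _ =>
      mul_nonneg (mul_nonneg (gibbs_pos β Φ z).le (logitP_nonneg β u z w)) (sq_nonneg _))
    rw [le_div_iff₀ hcard1]
    calc _ = (Fintype.card (∀ i, S i) : ℝ) ^ 2 * (E * (n * m)) := by ring
      _ ≤ ((m : ℝ) ^ n) ^ 2 * (E * (n * m)) := by gcongr
      _ = C := by rw [hC]; ring
  refine (tvDist_pow_le (gibbs_pos β Φ) (sum_gibbs β Φ) (sum_logitP hn hpot β)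
    (logitP_reversible hpot β) (logitP_posSemidef hpot β) hr0 hgap t x).trans ?_
  have hpow : (1 - 1 / C) ^ t ≤ Real.exp (-(t / C)) := by
    rw [show -((t : ℝ) / C) = t * (-(1 / C)) by ring, Real.exp_nat_mul]
    exact pow_le_pow_left₀ hr0 (Real.one_sub_le_exp_neg _) t
  have hinv : 1 / gibbs β Φ x ≤ Real.exp (n * Real.log m + β * maxVar Φ) := by
    rw [Real.exp_add, Real.exp_nat_mul, Real.exp_log hmpos]
    exact (inv_gibbs_le hβ Φ x).trans (by gcongr)
  have hexp : -(t / C) + (n * Real.log m + β * maxVar Φ) ≤ Real.log ε := by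
    rw [one_div, Real.log_inv, mul_comm, ← le_div_iff₀ hC0] at ht
    linarith
  calc (1 - 1 / C) ^ t / gibbs β Φ x = (1 - 1 / C) ^ t * (1 / gibbs β Φ x) := by ring
    _ ≤ Real.exp (-(t / C)) * Real.exp (n * Real.log m + β * maxVar Φ) :=
      mul_le_mul hpow hinv (one_div_pos.2 (gibbs_pos β Φ x)).le (Real.exp_pos _).le
    _ ≤ Real.exp (Real.log ε) := by rw [← Real.exp_add]; exact Real.exp_le_exp.2 hexp
    _ = ε := Real.exp_log hε
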